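/- arXiv:1707.07488 — 3 statements merged into one kernel-verified Lean document; each statement's English description precedes it below -/
import Mathlib

section
/- Fix an integer s ≥ 2 and γ ∈ (0,1). (a) If x ∈ (0, γ) with sx ∉ ℤ, and p = ⌊sx⌋ + 1 (i.e. x ∈ ((p−1)/s, p/s)), then Q_γ^j(x) ∉ [0,1) for 1 ≤ j ≤ p while Q_γ^{p+1}(x) = g(x) ∈ (0,1); in particular the first return time of x to [0,1) under Q_γ is p + 1 and the first return map equals g on (0,γ). (b) If x ∈ (γ, 1) with s²x ∉ ℤ, and p = ⌊s²x⌋ + 1 (i.e. x ∈ ((p−1)/s², p/s²)), then Q_γ^j(x) ∉ [0,1) for 1 ≤ j ≤ s² − p + 1 while Q_γ^{s²−p+2}(x) = g²(x) ∈ (0,1); in particular the first return time of x to [0,1) under Q_γ is s² − p + 2 and the first return map equals g² on (γ,1). -/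
/-- The piecewise affine map `Q_γ(x) = x + 1` for `x ≤ γ` and `Q_γ(x) = 1 + s(1 - x)` for
`x > γ`. -/
noncomputable def Q (s γ : ℝ) (x : ℝ) : ℝ := if x ≤ γ then x + 1 else 1 + s * (1 - x)

/-- The map `g(x) = s(1 − x) mod 1`. -/
noncomputable def gmap (s : ℕ) (x : ℝ) : ℝ := Int.fract ((s : ℝ) * (1 - x))

theorem Q_of_le {s γ x : ℝ} (h : x ≤ γ) : Q s γ x = x + 1 := if_pos h

theorem Q_of_lt {s γ x : ℝ} (h : γ < x) : Q s γ x = 1 + s * (1 - x) := if_neg h.not_ge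

/-- As long as `z, z + 1, …, z + (k - 1)` stay at or below `γ`, the map `Q_γ` acts by translation. -/
theorem iterate_Q_eq_add {s γ z : ℝ} (k : ℕ) (h : z + k ≤ γ + 1) :
    (Q s γ)^[k] z = z + k := by
  induction k with
  | zero => simp
  | succ k ih =>
    push_cast at h ⊢
    rw [Function.iterate_succ_apply', ih (by linarith), Q_of_le (by linarith)]
    ring

/-- If `Q_γ(x) ≥ 1` and `Q_γ²(x) = 1 - y` with `y ∈ (n - 1, n)`, then the orbit of `x` first returns
to `[0, 1)` at time `n + 1`, at the point `n - y`. -/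
theorem iterate_Q_first_return {s γ x y : ℝ} {n : ℕ} (hγ : 0 < γ) (hn : 1 ≤ n)
    (h1 : 1 ≤ Q s γ x) (h2 : Q s γ (Q s γ x) = 1 - y) (hy : y ∈ Set.Ioo ((n : ℝ) - 1) n) :
    (∀ j : ℕ, 1 ≤ j → j ≤ n → (Q s γ)^[j] x ∉ Set.Ico (0 : ℝ) 1) ∧
      (Q s γ)^[n + 1] x = n - y := by
  obtain ⟨hy1, hy2⟩ := hy
  have key : ∀ k : ℕ, k + 1 ≤ n → (Q s γ)^[k + 2] x = 1 - y + k := by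
    intro k hk
    have hk' : (k : ℝ) + 1 ≤ n := by exact_mod_cast hk
    rw [Function.iterate_add_apply]
    change (Q s γ)^[k] (Q s γ (Q s γ x)) = _
    rw [h2, iterate_Q_eq_add k (by linarith)]
  refine ⟨fun j hj hjn hmem => ?_, ?_⟩
  · obtain ⟨k, rfl⟩ := Nat.exists_eq_add_of_le' hj
    cases k with
    | zero => exact h1.not_gt hmem.2
    | succ k =>
      have hk : (k : ℝ) + 2 ≤ n := by exact_mod_cast hjn
      have h0 := hmem.1
      rw [key k (by omega)] at h0
      linarith
  · obtain ⟨k, rfl⟩ := Nat.exists_eq_add_of_le' hn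
    rw [key k le_rfl]
    push_cast
    ring

theorem fract_intCast_sub_eq {y : ℝ} {n : ℕ} (m : ℤ) (hy : y ∈ Set.Ioo ((n : ℝ) - 1) n) :
    Int.fract ((m : ℝ) - y) = n - y := by
  rw [Int.fract_eq_iff]
  refine ⟨by linarith [hy.2], by linarith [hy.1], m - n, ?_⟩
  push_cast
  ring

/-- description of the first return map of `Q_γ` to `[0,1)` for integer slope
`s ≥ 2` and `γ ∈ (0,1)`.
(a) If `x ∈ (0, γ)` lies in `((p−1)/s, p/s)` then `Q_γ^j(x) ∉ [0,1)` for `1 ≤ j ≤ p` and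
`Q_γ^{p+1}(x) = g(x) ∈ (0,1)`: the first return time is `p + 1` and the return map is `g`.
(b) If `x ∈ (γ, 1)` lies in `((p−1)/s², p/s²)` then `Q_γ^j(x) ∉ [0,1)` for
`1 ≤ j ≤ s² − p + 1` and `Q_γ^{s²−p+2}(x) = g²(x) ∈ (0,1)`: the first return time is
`s² − p + 2` and the return map is `g²`. -/
theorem first_return_map_eq_g (s : ℕ) (hs : 2 ≤ s) (γ : ℝ) (hγ : γ ∈ Set.Ioo (0 : ℝ) 1)
    (x : ℝ) :
    (∀ p : ℕ, x ∈ Set.Ioo (0 : ℝ) γ →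
      x ∈ Set.Ioo (((p : ℝ) - 1) / s) ((p : ℝ) / s) →
      (∀ j : ℕ, 1 ≤ j → j ≤ p → (Q s γ)^[j] x ∉ Set.Ico (0 : ℝ) 1) ∧
      (Q s γ)^[p + 1] x = gmap s x ∧ gmap s x ∈ Set.Ioo (0 : ℝ) 1) ∧
    (∀ p : ℕ, x ∈ Set.Ioo γ 1 →
      x ∈ Set.Ioo (((p : ℝ) - 1) / (s ^ 2)) ((p : ℝ) / (s ^ 2)) →
      (∀ j : ℕ, 1 ≤ j → j ≤ s ^ 2 - p + 1 → (Q s γ)^[j] x ∉ Set.Ico (0 : ℝ) 1) ∧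
      (Q s γ)^[s ^ 2 - p + 2] x = gmap s (gmap s x) ∧
      gmap s (gmap s x) ∈ Set.Ioo (0 : ℝ) 1) := by
  obtain ⟨hγ0, hγ1⟩ := hγ
  have hs0 : (0 : ℝ) < s := by exact_mod_cast (by omega : 0 < s)
  have hs2 : (0 : ℝ) < (s : ℝ) ^ 2 := by positivity
  refine ⟨?_, ?_⟩
  · rintro p ⟨hx0, hxγ⟩ ⟨hp1, hp2⟩
    rw [div_lt_iff₀ hs0] at hp1
    rw [lt_div_iff₀ hs0] at hp2
    have hp : 1 ≤ p := by
      have : (0 : ℝ) < p := (mul_pos hx0 hs0).trans hp2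
      exact_mod_cast this
    have hQ : Q s γ x = x + 1 := Q_of_le hxγ.le
    have hy : x * s ∈ Set.Ioo ((p : ℝ) - 1) p := ⟨hp1, hp2⟩
    have hg : gmap s x = p - x * s := by
      rw [← fract_intCast_sub_eq s hy, gmap]
      congr 1
      push_cast
      ring
    obtain ⟨hout, hret⟩ := iterate_Q_first_return (s := s) hγ0 hp (by rw [hQ]; linarith)
      (by rw [hQ, Q_of_lt (by linarith)]; ring) hy
    exact ⟨hout, hret.trans hg.symm, by rw [hg]; constructor <;> linarith⟩
  · rintro p ⟨hxγ, hx1⟩ ⟨hp1, hp2⟩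
    rw [div_lt_iff₀ hs2] at hp1
    rw [lt_div_iff₀ hs2] at hp2
    have hp : p ≤ s ^ 2 := by
      have : (p : ℝ) < (s : ℝ) ^ 2 + 1 := by nlinarith
      exact Nat.lt_succ_iff.mp (by exact_mod_cast this)
    have hn : ((s ^ 2 - p + 1 : ℕ) : ℝ) = (s : ℝ) ^ 2 - p + 1 := by
      push_cast [Nat.cast_sub hp]
      ring
    have hQ : Q s γ x = 1 + s * (1 - x) := Q_of_lt hxγ
    have hpos : 0 < (s : ℝ) * (1 - x) := mul_pos hs0 (by linarith)
    have hy : (s : ℝ) ^ 2 * (1 - x) ∈ Set.Ioo (((s ^ 2 - p + 1 : ℕ) : ℝ) - 1)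
        ((s ^ 2 - p + 1 : ℕ) : ℝ) := by
      rw [hn]
      constructor <;> linarith
    have hg : gmap s (gmap s x) = ((s ^ 2 - p + 1 : ℕ) : ℝ) - (s : ℝ) ^ 2 * (1 - x) := by
      rw [← fract_intCast_sub_eq (s + s * ⌊(s : ℝ) * (1 - x)⌋) hy, gmap, gmap]
      congr 1
      rw [← Int.self_sub_floor]
      push_cast
      ring
    obtain ⟨hout, hret⟩ := iterate_Q_first_return (s := s) hγ0 (Nat.le_add_left 1 (s ^ 2 - p))
      (by rw [hQ]; linarith) (by rw [hQ, Q_of_lt (by linarith)]; ring) hy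
    exact ⟨hout, hret.trans hg.symm, by rw [hg]; constructor <;> linarith [hy.1, hy.2]⟩
end

section
/- Fix an integer s ≥ 2. For every t ∈ (0,1], the set K(t) has Lebesgue measure zero. Moreover, the Hausdorff dimension of K(t) tends to 1 as t → 0⁺: for every ε > 0 there exists t₀ > 0 such that for all t ∈ (0, t₀) the Hausdorff dimension of K(t) exceeds 1 − ε. -/
open MeasureTheory

/-- `K(t) = {x ∈ [0,1] : g^k(x) ≥ t for all k ≥ 0}`. -/
noncomputable def Kset (s : ℕ) (t : ℝ) : Set ℝ :=
  {x ∈ Set.Icc (0 : ℝ) 1 | ∀ k : ℕ, t ≤ (gmap s)^[k] x}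

lemma gmap_mem_Icc (s : ℕ) (x : ℝ) : gmap s x ∈ Set.Icc (0 : ℝ) 1 :=
  ⟨Int.fract_nonneg _, (Int.fract_lt_one _).le⟩

lemma gmap_iterate_mem_Icc (s : ℕ) {x : ℝ} (hx : x ∈ Set.Icc (0 : ℝ) 1) (k : ℕ) :
    (gmap s)^[k] x ∈ Set.Icc (0 : ℝ) 1 := by
  cases k with
  | zero => exact hx
  | succ k => rw [Function.iterate_succ_apply']; exact gmap_mem_Icc s _

/-- The orbit of `x` under `gmap s` agrees modulo `1`, up to sign, with `s ^ k * x`. -/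
lemma exists_gmap_iterate_eq (s : ℕ) (x : ℝ) (k : ℕ) :
    ∃ n : ℤ, (gmap s)^[k] x = (-(s : ℝ)) ^ k * x + n := by
  induction k with
  | zero => exact ⟨0, by simp⟩
  | succ k ih =>
    obtain ⟨n, hn⟩ := ih
    refine ⟨s - s * n - ⌊(s : ℝ) * (1 - (gmap s)^[k] x)⌋, ?_⟩
    rw [Function.iterate_succ_apply', gmap, Int.fract, hn]
    push_cast
    ring

lemma Kset_anti (s : ℕ) {t u : ℝ} (h : t ≤ u) : Kset s u ⊆ Kset s t :=
  fun _ hx => ⟨hx.1, fun k => h.trans (hx.2 k)⟩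

section MeasureZero

lemma coe_gmap (s : ℕ) (x : ℝ) :
    ((gmap s x : ℝ) : UnitAddCircle) = (-(s : ℤ)) • (x : UnitAddCircle) := by
  rw [← AddCircle.coe_zsmul, ← sub_eq_zero, ← AddCircle.coe_sub, AddCircle.coe_eq_zero_iff]
  refine ⟨s - ⌊(s : ℝ) * (1 - x)⌋, ?_⟩
  simp only [gmap, Int.fract, zsmul_eq_mul]
  push_cast
  ring

lemma coe_gmap_iterate (s : ℕ) (x : ℝ) (k : ℕ) :
    (((gmap s)^[k] x : ℝ) : UnitAddCircle) =
      (fun y : UnitAddCircle => (-(s : ℤ)) • y)^[k] (x : UnitAddCircle) :=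
  (Function.Semiconj.iterate_right (f := ((↑) : ℝ → UnitAddCircle)) (coe_gmap s) k) x

lemma volume_Kset_eq_zero {s : ℕ} (hs : 2 ≤ s) {t : ℝ} (ht : t ∈ Set.Ioc (0 : ℝ) 1) :
    volume (Kset s t) = 0 := by
  have herg : Ergodic (fun y : UnitAddCircle => (-(s : ℤ)) • y) volume :=
    AddCircle.ergodic_zsmul (by rw [abs_neg]; simp; omega)
  set T : UnitAddCircle → UnitAddCircle := fun y => (-(s : ℤ)) • y with hT
  set U : Set UnitAddCircle := ((↑) : ℝ → UnitAddCircle) '' Set.Ioo 0 t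
  have hUo : IsOpen U := QuotientAddGroup.isOpenMap_coe _ isOpen_Ioo
  have hTc : Continuous T := continuous_zsmul _
  set W : Set UnitAddCircle := ⋃ k : ℕ, T^[k] ⁻¹' U
  have hWo : IsOpen W := isOpen_iUnion fun k => hUo.preimage (hTc.iterate k)
  have hWU : U ⊆ W := fun y hy => Set.mem_iUnion.2 ⟨0, hy⟩
  have hUne : U.Nonempty := (Set.nonempty_Ioo.2 ht.1).image _
  have hTW : T ⁻¹' W ⊆ W := by
    intro y hy
    obtain ⟨k, hk⟩ := Set.mem_iUnion.1 hy
    exact Set.mem_iUnion.2 ⟨k + 1, by simpa [Function.iterate_succ_apply] using hk⟩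
  have hWc : volume Wᶜ = 0 := by
    rcases herg.ae_empty_or_univ_of_preimage_ae_le hWo.measurableSet.nullMeasurableSet
      hTW.eventuallyLE with h | h
    · exact absurd (ae_eq_empty.1 h) (hWo.measure_pos _ (hUne.mono hWU)).ne'
    · exact ae_eq_univ.1 h
  have hdisj : Kset s t ⊆ {0} ∪ (((↑) : ℝ → UnitAddCircle) ⁻¹' Wᶜ ∩ Set.Ioc 0 1) := by
    intro x hx
    rcases hx.1.1.eq_or_lt with h0 | h0
    · exact Or.inl h0.symm
    refine Or.inr ⟨fun hxW => ?_, h0, hx.1.2⟩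
    obtain ⟨k, u, hu, hk⟩ := Set.mem_iUnion.1 hxW
    rw [hT, ← coe_gmap_iterate] at hk
    have hmem := gmap_iterate_mem_Icc s hx.1 k
    have hle := hx.2 k
    obtain ⟨n, hn⟩ := AddCircle.coe_eq_zero_iff 1 |>.1
      (show (((gmap s)^[k] x - u : ℝ) : UnitAddCircle) = 0 by
        rw [AddCircle.coe_sub, hk, sub_self])
    rw [zsmul_eq_mul, mul_one] at hn
    have h1 : (n : ℝ) < 1 := by linarith [hmem.2, hu.1]
    have h2 : (0 : ℝ) < n := by linarith [hu.2]
    have h1' : n < 1 := by exact_mod_cast h1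
    have h2' : 0 < n := by exact_mod_cast h2
    omega
  have hpre := (UnitAddCircle.measurePreserving_mk 0).measure_preimage
    hWo.measurableSet.compl.nullMeasurableSet
  rw [hWc, zero_add, Measure.restrict_apply
    ((UnitAddCircle.measurePreserving_mk 0).measurable hWo.measurableSet.compl)] at hpre
  exact measure_mono_null hdisj (measure_union_null (by simp) hpre)

end MeasureZero

section Dimension

/-- A point of `[0, 1]` all of whose multiples `b ^ k * x` with `b = s ^ m` stay at distance at
least `1 / b` from the integers has a `gmap s`-orbit bounded below by `1 / b ^ 2`. -/
lemma mem_Kset_of_dist_int {s m : ℕ} (hs : 1 ≤ s) {x : ℝ} (hx : x ∈ Set.Icc (0 : ℝ) 1)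
    (h : ∀ (k : ℕ) (n : ℤ), ((s : ℝ) ^ m)⁻¹ ≤ |((s : ℝ) ^ m) ^ k * x - n|) :
    x ∈ Kset s ((((s : ℝ) ^ m) ^ 2)⁻¹) := by
  have hs' : (1 : ℝ) ≤ s := by exact_mod_cast hs
  have hs0 : (0 : ℝ) < s := by linarith
  have hdist : ∀ (j : ℕ) (n : ℤ), (((s : ℝ) ^ m) ^ 2)⁻¹ ≤ |(s : ℝ) ^ j * x - n| := by
    intro j n
    rcases Nat.eq_zero_or_pos m with rfl | hm
    · have := h 0 0
      have h1 := h 0 1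
      simp only [pow_zero, inv_one, one_mul, Int.cast_zero, sub_zero, Int.cast_one] at this h1
      rw [abs_of_nonneg hx.1] at this
      rw [abs_of_nonpos (by linarith [hx.2])] at h1
      linarith
    obtain ⟨i, him, hi⟩ : ∃ i ≤ m, i + j = m * (j / m + 1) := by
      refine ⟨m - j % m, Nat.sub_le _ _, ?_⟩
      have := Nat.div_add_mod j m
      have := Nat.mod_lt j hm
      rw [mul_add, mul_one]
      omega
    have key := h (j / m + 1) (s ^ i * n)
    rw [← pow_mul, ← hi, pow_add] at key
    push_cast at key
    rw [mul_assoc, ← mul_sub, abs_mul, abs_of_pos (pow_pos hs0 i)] at key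
    have h2 : (s : ℝ) ^ i * |(s : ℝ) ^ j * x - n| ≤ (s : ℝ) ^ m * |(s : ℝ) ^ j * x - n| := by
      gcongr
    rw [pow_two, mul_inv, ← div_eq_inv_mul, div_le_iff₀' (pow_pos hs0 m)]
    exact key.trans h2
  refine ⟨hx, fun k => ?_⟩
  rw [← abs_of_nonneg (gmap_iterate_mem_Icc s hx k).1]
  obtain ⟨n, hn⟩ := exists_gmap_iterate_eq s x k
  rw [hn]
  rcases Nat.even_or_odd k with hk | hk
  · rw [hk.neg_pow]
    simpa using hdist k (-n)
  · rw [hk.neg_pow, ← abs_neg]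
    convert hdist k n using 2
    ring

variable {N : ℕ}

/-- The real number with base `N + 2` digits `e i + 1`, avoiding the smallest and the largest
digit. -/
noncomputable def ofInnerDigits (e : ℕ → Fin N) : ℝ :=
  Real.ofDigits (b := N + 2) fun i => (e i).succ.castSucc

lemma ofInnerDigits_eq_sum_add (e : ℕ → Fin N) (k : ℕ) :
    ofInnerDigits e =
      (∑ i ∈ Finset.range k, ((e i : ℝ) + 1) * (((N : ℝ) + 2) ^ (i + 1))⁻¹) +
        (((N : ℝ) + 2) ^ k)⁻¹ * ofInnerDigits fun i => e (i + k) := by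
  have := Real.ofDigits_eq_sum_add_ofDigits (b := N + 2) (fun i => (e i).succ.castSucc) k
  simpa [ofInnerDigits, Real.ofDigitsTerm] using this

lemma ofInnerDigits_eq_head_add (e : ℕ → Fin N) :
    ofInnerDigits e =
      ((e 0 : ℝ) + 1) / ((N : ℝ) + 2) + (ofInnerDigits fun i => e (i + 1)) / ((N : ℝ) + 2) := by
  rw [ofInnerDigits_eq_sum_add e 1]
  simp [div_eq_mul_inv, mul_comm]

lemma ofInnerDigits_mem_Icc (e : ℕ → Fin N) :
    ofInnerDigits e ∈ Set.Icc (((N : ℝ) + 2)⁻¹) (1 - ((N : ℝ) + 2)⁻¹) := by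
  have h0 : 0 ≤ ofInnerDigits fun i => e (i + 1) := Real.ofDigits_nonneg _
  have h1 : ofInnerDigits (fun i => e (i + 1)) ≤ 1 := Real.ofDigits_le_one _
  have he : (e 0 : ℝ) + 1 ≤ N := by exact_mod_cast (e 0).isLt
  have he0 : (0 : ℝ) ≤ e 0 := Nat.cast_nonneg _
  have hN : (0 : ℝ) < N + 2 := by positivity
  rw [ofInnerDigits_eq_head_add]
  constructor
  · rw [← add_div, inv_eq_one_div]
    gcongr
    linarith
  · rw [← add_div, div_le_iff₀ hN, sub_mul, inv_mul_cancel₀ hN.ne']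
    linarith

lemma inv_le_abs_pow_mul_ofInnerDigits_sub (e : ℕ → Fin N) (k : ℕ) (n : ℤ) :
    ((N : ℝ) + 2)⁻¹ ≤ |((N : ℝ) + 2) ^ k * ofInnerDigits e - n| := by
  have hN : (0 : ℝ) < N + 2 := by positivity
  obtain ⟨z, hz⟩ : ∃ z : ℤ, ((N : ℝ) + 2) ^ k * ofInnerDigits e =
      z + ofInnerDigits fun i => e (i + k) := by
    refine ⟨∑ i ∈ Finset.range k, ((e i : ℤ) + 1) * ((N : ℤ) + 2) ^ (k - (i + 1)), ?_⟩
    rw [ofInnerDigits_eq_sum_add e k, mul_add, mul_inv_cancel_left₀ (pow_pos hN k).ne',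
      Finset.mul_sum]
    push_cast
    congr 1
    refine Finset.sum_congr rfl fun i hi => ?_
    rw [pow_sub₀ _ hN.ne' (by simpa using hi)]
    ring
  obtain ⟨h1, h2⟩ := ofInnerDigits_mem_Icc fun i => e (i + k)
  rw [hz]
  rcases le_or_gt n z with h | h
  · have h' : (n : ℝ) ≤ z := by exact_mod_cast h
    exact le_trans (by linarith) (le_abs_self _)
  · have h' : (z : ℝ) + 1 ≤ n := by exact_mod_cast h
    exact le_trans (by linarith) (neg_le_abs _)

/-- Digit sequences that first differ at position `k` give numbers at distance at least
`(N + 2) ^ (-(k + 2))`. -/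
lemma inv_pow_le_abs_ofInnerDigits_sub {e e' : ℕ → Fin N} {k : ℕ}
    (hlt : ∀ i < k, e i = e' i) (hk : e k ≠ e' k) :
    (((N : ℝ) + 2) ^ (k + 2))⁻¹ ≤ |ofInnerDigits e - ofInnerDigits e'| := by
  wlog h : e' k < e k generalizing e e'
  · rw [abs_sub_comm]
    exact this (fun i hi => (hlt i hi).symm) hk.symm (lt_of_le_of_ne (not_lt.1 h) hk)
  have hN : (0 : ℝ) < N + 2 := by positivity
  have hsum : ∑ i ∈ Finset.range k, ((e i : ℝ) + 1) * (((N : ℝ) + 2) ^ (i + 1))⁻¹ =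
      ∑ i ∈ Finset.range k, ((e' i : ℝ) + 1) * (((N : ℝ) + 2) ^ (i + 1))⁻¹ :=
    Finset.sum_congr rfl fun i hi => by rw [hlt i (Finset.mem_range.1 hi)]
  rw [ofInnerDigits_eq_sum_add e k, ofInnerDigits_eq_sum_add e' k, hsum, add_sub_add_left_eq_sub,
    ← mul_sub, ofInnerDigits_eq_head_add fun i => e (i + k),
    ofInnerDigits_eq_head_add fun i => e' (i + k)]
  obtain ⟨h1, -⟩ := ofInnerDigits_mem_Icc fun i => e (i + 1 + k)
  obtain ⟨-, h2⟩ := ofInnerDigits_mem_Icc fun i => e' (i + 1 + k)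
  have hd : (e' k : ℝ) + 1 ≤ e k := by exact_mod_cast h
  have hpos : (0 : ℝ) < ((N : ℝ) + 2)⁻¹ := inv_pos.2 hN
  rw [pow_add, mul_inv]
  refine le_trans ?_ (le_abs_self _)
  refine mul_le_mul_of_nonneg_left ?_ (by positivity)
  rw [← add_div, ← add_div, ← sub_div, le_div_iff₀ hN, pow_two, mul_inv,
    inv_mul_cancel_right₀ hN.ne']
  simp only [zero_add]
  linarith

/-- The Hölder exponent of the map sending a number written with inner base `N + 2` digits to the
number with the corresponding base `N` digits. -/
noncomputable def innerDigitsExponent (N : ℕ) : NNReal :=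
  (Real.log N / Real.log (N + 2)).toNNReal

lemma coe_innerDigitsExponent (N : ℕ) :
    (innerDigitsExponent N : ℝ) = Real.log N / Real.log (N + 2) :=
  Real.coe_toNNReal _ (div_nonneg (Real.log_natCast_nonneg N)
    (Real.log_nonneg (by linarith [(Nat.cast_nonneg N : (0 : ℝ) ≤ N)])))

lemma innerDigitsExponent_pos (hN : 1 < N) : 0 < innerDigitsExponent N := by
  have h : (1 : ℝ) < N := by exact_mod_cast hN
  exact Real.toNNReal_pos.2 (div_pos (Real.log_pos h) (Real.log_pos (by linarith)))

lemma rpow_innerDigitsExponent (hN : 1 < N) :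
    ((N : ℝ) + 2) ^ (innerDigitsExponent N : ℝ) = N := by
  have h : (1 : ℝ) < N := by exact_mod_cast hN
  rw [coe_innerDigitsExponent, Real.rpow_def_of_pos (by linarith),
    mul_div_cancel₀ _ (Real.log_pos (by linarith)).ne', Real.exp_log (by linarith)]

lemma abs_ofDigits_sub_le_ofInnerDigits (hN : 1 < N) (e e' : ℕ → Fin N) :
    |Real.ofDigits e - Real.ofDigits e'| ≤
      (N : ℝ) ^ 2 * |ofInnerDigits e - ofInnerDigits e'| ^ (innerDigitsExponent N : ℝ) := by
  classical
  by_cases hee : e = e'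
  · subst hee
    simp only [sub_self, abs_zero]
    positivity
  have hex : ∃ k, e k ≠ e' k := Function.ne_iff.1 hee
  set k := Nat.find hex
  have hk : e k ≠ e' k := Nat.find_spec hex
  have hlt : ∀ i < k, e i = e' i := fun i hi => not_not.1 (Nat.find_min hex hi)
  have hN0 : (0 : ℝ) < N := by exact_mod_cast (by omega : 0 < N)
  have h2 := Real.rpow_le_rpow (by positivity) (inv_pow_le_abs_ofInnerDigits_sub hlt hk)
    (innerDigitsExponent N).coe_nonneg
  rw [Real.inv_rpow (by positivity), ← Real.rpow_pow_comm (by positivity),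
    rpow_innerDigitsExponent hN] at h2
  calc |Real.ofDigits e - Real.ofDigits e'| ≤ ((N : ℝ) ^ k)⁻¹ :=
        Real.abs_ofDigits_sub_ofDigits_le hlt
    _ = (N : ℝ) ^ 2 * ((N : ℝ) ^ (k + 2))⁻¹ := by
        field_simp
        ring
    _ ≤ _ := by gcongr

lemma innerDigitsExponent_le_dimH_range (hN : 1 < N) :
    (innerDigitsExponent N : ENNReal) ≤ dimH (Set.range (ofInnerDigits (N := N))) := by
  have : Nonempty (ℕ → Fin N) := ⟨fun _ => ⟨0, by omega⟩⟩
  set r := innerDigitsExponent N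
  set f : ℝ → ℝ := fun x => Real.ofDigits (Function.invFun (ofInnerDigits (N := N)) x)
  have hinv : ∀ e : ℕ → Fin N,
      ofInnerDigits (Function.invFun (ofInnerDigits (N := N)) (ofInnerDigits e)) =
        ofInnerDigits e := fun e => Function.invFun_eq ⟨e, rfl⟩
  have hr0 := innerDigitsExponent_pos hN
  have hfe : ∀ e : ℕ → Fin N, f (ofInnerDigits e) = Real.ofDigits e := by
    intro e
    have := abs_ofDigits_sub_le_ofInnerDigits hN
      (Function.invFun (ofInnerDigits (N := N)) (ofInnerDigits e)) e
    rw [hinv, sub_self, abs_zero, Real.zero_rpow (NNReal.coe_pos.2 hr0).ne', mul_zero] at this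
    exact sub_eq_zero.1 (abs_nonpos_iff.1 this)
  have hhold : HolderOnWith ((N : NNReal) ^ 2) r f (Set.range (ofInnerDigits (N := N))) := by
    rintro _ ⟨e, rfl⟩ _ ⟨e', rfl⟩
    rw [hfe, hfe, edist_dist, edist_dist, Real.dist_eq, Real.dist_eq,
      ENNReal.ofReal_rpow_of_nonneg (abs_nonneg _) r.coe_nonneg]
    have h := ENNReal.ofReal_le_ofReal (abs_ofDigits_sub_le_ofInnerDigits hN e e')
    rw [ENNReal.ofReal_mul (by positivity)] at h
    convert h using 2
    rw [ENNReal.ofReal_pow (by positivity)]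
    simp
  have himg : Set.Icc (0 : ℝ) 1 ⊆ f '' Set.range (ofInnerDigits (N := N)) := by
    intro y hy
    obtain ⟨e, -, rfl⟩ := Real.ofDigits_SurjOn hN hy
    exact ⟨_, ⟨e, rfl⟩, hfe e⟩
  have hone : (1 : ENNReal) ≤ dimH (Set.range (ofInnerDigits (N := N))) / r := by
    refine le_trans ?_ ((dimH_mono himg).trans (hhold.dimH_image_le hr0))
    rw [Real.dimH_of_nonempty_interior (by simp [interior_Icc])]
    simp
  rw [ENNReal.le_div_iff_mul_le (Or.inl (by simpa using hr0.ne')) (Or.inl ENNReal.coe_ne_top),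
    one_mul] at hone
  exact hone

/-- If `N + 2 = s ^ m` then the Hölder exponent is at least `1 - 1 / m`. -/
lemma one_sub_inv_le_innerDigitsExponent {s m : ℕ} (hs : 2 ≤ s) (hN : 1 < N)
    (h : N + 2 = s ^ m) : 1 - (m : ℝ)⁻¹ ≤ innerDigitsExponent N := by
  have hN' : (2 : ℝ) ≤ N := by exact_mod_cast hN
  have hs' : (2 : ℝ) ≤ s := by exact_mod_cast hs
  have hm : 0 < m := by
    rcases Nat.eq_zero_or_pos m with rfl | hm
    · simp at h
    · exact hm
  have hm' : (0 : ℝ) < m := by exact_mod_cast hm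
  have hlog : 0 < Real.log ((N : ℝ) + 2) := Real.log_pos (by linarith)
  have hNs : Real.log ((N : ℝ) + 2) = m * Real.log s := by
    rw [← Real.log_pow]
    congr 1
    exact_mod_cast h
  have h1 : Real.log ((N : ℝ) + 2) ≤ Real.log N + Real.log 2 := by
    rw [← Real.log_mul (by linarith) (by norm_num)]
    exact Real.log_le_log (by linarith) (by linarith)
  have h2 : Real.log 2 ≤ Real.log s := Real.log_le_log (by norm_num) hs'
  rw [coe_innerDigitsExponent, le_div_iff₀ hlog, sub_mul, hNs, inv_mul_cancel_left₀ hm'.ne',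
    one_mul]
  linarith

lemma range_ofInnerDigits_subset_Kset {s m : ℕ} (hs : 1 ≤ s) (h : N + 2 = s ^ m) :
    Set.range (ofInnerDigits (N := N)) ⊆ Kset s ((((s : ℝ) ^ m) ^ 2)⁻¹) := by
  rintro _ ⟨e, rfl⟩
  have h' : (N : ℝ) + 2 = (s : ℝ) ^ m := by exact_mod_cast h
  refine mem_Kset_of_dist_int hs ⟨Real.ofDigits_nonneg _, Real.ofDigits_le_one _⟩ fun k n => ?_
  rw [← h']
  exact inv_le_abs_pow_mul_ofInnerDigits_sub e k n

lemma exists_forall_lt_dimH_Kset {s : ℕ} (hs : 2 ≤ s) {ε : ℝ} (hε : 0 < ε) :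
    ∃ t₀ > (0 : ℝ), ∀ t : ℝ, t < t₀ → ENNReal.ofReal (1 - ε) < dimH (Kset s t) := by
  obtain ⟨m₀, hm₀⟩ := exists_nat_gt ε⁻¹
  set m := m₀ + 2 with hm
  have hpow : 4 ≤ s ^ m := calc
    4 = 2 ^ 2 := by norm_num
    _ ≤ s ^ 2 := Nat.pow_le_pow_left hs 2
    _ ≤ s ^ m := Nat.pow_le_pow_right (by omega) (by omega)
  obtain ⟨N, hN⟩ : ∃ N, N + 2 = s ^ m := ⟨s ^ m - 2, by omega⟩
  have hN1 : 1 < N := by omega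
  have hs0 : (0 : ℝ) < s := by exact_mod_cast (by omega : 0 < s)
  refine ⟨(((s : ℝ) ^ m) ^ 2)⁻¹, by positivity, fun t ht => ?_⟩
  have hinv : (m : ℝ)⁻¹ < ε := by
    refine inv_lt_of_inv_lt₀ hε (hm₀.trans ?_)
    rw [hm]
    push_cast
    linarith
  have hexp := one_sub_inv_le_innerDigitsExponent hs hN1 hN
  calc ENNReal.ofReal (1 - ε) < innerDigitsExponent N := by
        rw [ENNReal.ofReal, ENNReal.coe_lt_coe, ← NNReal.coe_lt_coe, Real.coe_toNNReal',
          max_lt_iff]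
        exact ⟨by linarith, NNReal.coe_pos.2 (innerDigitsExponent_pos hN1)⟩
    _ ≤ dimH (Set.range (ofInnerDigits (N := N))) := innerDigitsExponent_le_dimH_range hN1
    _ ≤ dimH (Kset s t) := dimH_mono
        ((range_ofInnerDigits_subset_Kset (by omega) hN).trans (Kset_anti s ht.le))

end Dimension

/-- for every `t ∈ (0,1]` the set `K(t)` has Lebesgue measure zero, and the
Hausdorff dimension of `K(t)` tends to `1` as `t → 0⁺`. -/
theorem Kset_measure_zero_and_dimension (s : ℕ) (hs : 2 ≤ s) :
    (∀ t ∈ Set.Ioc (0 : ℝ) 1, volume (Kset s t) = 0) ∧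
    (∀ ε : ℝ, 0 < ε → ∃ t₀ > (0 : ℝ), ∀ t : ℝ, 0 < t → t < t₀ →
      ENNReal.ofReal (1 - ε) < dimH (Kset s t)) := by
  exact ⟨fun t ht => volume_Kset_eq_zero hs ht, fun ε hε =>
    let ⟨t₀, h₀, h⟩ := exists_forall_lt_dimH_Kset hs hε
    ⟨t₀, h₀, fun t _ ht => h t ht⟩⟩
end

section
/- Fix an integer s ≥ 2 and let ξ ∈ ℚ_s ∩ (0,1), with w the shortest even-length base-s expansion of ξ and v the shortest odd-length base-s expansion of 1 − ξ. Then ξ_L < ξ < ξ_R and the open interval I_ξ := (ξ_L, ξ_R) is disjoint from the bifurcation set E. Consequently [0, s/(s+1)] \ E contains the union of the intervals I_ξ over all ξ ∈ ℚ_s ∩ (0, s/(s+1)). -/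
/-- The value `.w = Σ εᵢ s^{-i}` of a finite word of digits in base `s`. -/
noncomputable def sval (s : ℕ) (w : List ℕ) : ℝ :=
  w.foldr (fun d r => ((d : ℝ) + r) / s) 0

/-- The value `.\overline{w}` of the purely periodic base-`s` expansion repeating `w`. -/
noncomputable def pval (s : ℕ) (w : List ℕ) : ℝ :=
  sval s w * (s : ℝ) ^ w.length / ((s : ℝ) ^ w.length - 1)

/-- Digit-wise flip `ε ↦ s − 1 − ε` of a word. -/
def flipw (s : ℕ) (w : List ℕ) : List ℕ := w.map (fun d => s - 1 - d)

/-- `w` is the shortest base-`s` expansion of `x` of even length. -/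
noncomputable def IsEvenExp (s : ℕ) (x : ℝ) (w : List ℕ) : Prop :=
  w ≠ [] ∧ (∀ d ∈ w, d < s) ∧ Even w.length ∧ sval s w = x ∧
  ∀ w' : List ℕ, (∀ d ∈ w', d < s) → Even w'.length → sval s w' = x →
    w.length ≤ w'.length

/-- `v` is the shortest base-`s` expansion of `x` of odd length. -/
noncomputable def IsOddExp (s : ℕ) (x : ℝ) (v : List ℕ) : Prop :=
  (∀ d ∈ v, d < s) ∧ Odd v.length ∧ sval s v = x ∧
  ∀ v' : List ℕ, (∀ d ∈ v', d < s) → Odd v'.length → sval s v' = x →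
    v.length ≤ v'.length

/-- `x` is an `s`-adic rational `p/s^m`. -/
def IsSAdic (s : ℕ) (x : ℝ) : Prop := ∃ p m : ℕ, x = (p : ℝ) / (s : ℝ) ^ m

/-- The bifurcation set `E = {γ ∈ [0,1] : g^k(γ) ≥ γ for all k ≥ 1}`. -/
noncomputable def Eset (s : ℕ) : Set ℝ :=
  {γ ∈ Set.Icc (0 : ℝ) 1 | ∀ k : ℕ, 1 ≤ k → γ ≤ (gmap s)^[k] γ}

theorem sval_cons (s d : ℕ) (w : List ℕ) :
    sval s (d :: w) = ((d : ℝ) + sval s w) / s := rfl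

/-- A finite word of length `n` has value `p / s ^ n` for a natural number `p`. -/
theorem exists_nat_eq_sval_mul_pow {s : ℕ} (hs : s ≠ 0) (w : List ℕ) :
    ∃ p : ℕ, sval s w * (s : ℝ) ^ w.length = p := by
  have hs' : (s : ℝ) ≠ 0 := by exact_mod_cast hs
  induction w with
  | nil => exact ⟨0, by simp [sval]⟩
  | cons d w ih =>
    obtain ⟨p, hp⟩ := ih
    refine ⟨d * s ^ w.length + p, ?_⟩
    rw [sval_cons, List.length_cons, pow_succ]
    push_cast
    rw [← hp]
    field_simp

theorem sval_append {s : ℕ} (hs : s ≠ 0) (a b : List ℕ) :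
    sval s (a ++ b) = sval s a + sval s b / (s : ℝ) ^ a.length := by
  have hs' : (s : ℝ) ≠ 0 := by exact_mod_cast hs
  induction a with
  | nil => simp [sval]
  | cons d a ih =>
    rw [List.cons_append, sval_cons, ih, sval_cons, List.length_cons, pow_succ]
    field_simp
    ring

theorem sval_flipw {s : ℕ} (hs : s ≠ 0) {v : List ℕ} (hv : ∀ d ∈ v, d < s) :
    sval s (flipw s v) = 1 - sval s v - 1 / (s : ℝ) ^ v.length := by
  have hs' : (s : ℝ) ≠ 0 := by exact_mod_cast hs
  induction v with
  | nil => simp [sval, flipw]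
  | cons d v ih =>
    have hd : d < s := hv d (by simp)
    have hcast : ((s - 1 - d : ℕ) : ℝ) = s - 1 - d := by
      rw [Nat.cast_sub (by omega), Nat.cast_sub (by omega), Nat.cast_one]
    have ih' := ih fun e he => hv e (by simp [he])
    change sval s ((s - 1 - d) :: flipw s v) = _
    rw [sval_cons, ih', hcast, sval_cons, List.length_cons, pow_succ]
    field_simp
    ring

/-- The periodic expansion `.\overline{v̌v}` equals `s ^ n * (1 - .v) / (s ^ n + 1)`
with `n` the length of `v`. -/
theorem pval_flipw_append {s : ℕ} (hs : 2 ≤ s) {v : List ℕ} (hv : ∀ d ∈ v, d < s)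
    (hne : v.length ≠ 0) :
    pval s (flipw s v ++ v) =
      (s : ℝ) ^ v.length * (1 - sval s v) / ((s : ℝ) ^ v.length + 1) := by
  have hs1 : (1 : ℝ) < s := by exact_mod_cast hs
  have hN : 1 < (s : ℝ) ^ v.length := one_lt_pow₀ hs1 hne
  have hlen : (flipw s v).length = v.length := by simp [flipw]
  rw [pval, sval_append (by omega), sval_flipw (by omega) hv, List.length_append, hlen, pow_add]
  generalize (s : ℝ) ^ v.length = N at hN
  have h1 : N * N - 1 ≠ 0 := by nlinarith
  have h2 : N + 1 ≠ 0 := by linarith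
  have h3 : N ≠ 0 := by linarith
  rw [div_eq_div_iff h1 h2]
  field_simp
  ring

theorem gmap_fract (s : ℕ) (y : ℝ) : gmap s (Int.fract y) = Int.fract (-(s : ℝ) * y) := by
  rw [gmap, Int.fract_eq_fract]
  refine ⟨s + s * ⌊y⌋, ?_⟩
  rw [Int.fract]
  push_cast
  ring

theorem gmap_iterate_succ (s k : ℕ) (x : ℝ) :
    (gmap s)^[k + 1] x = Int.fract ((-(s : ℝ)) ^ (k + 1) * x) := by
  induction k with
  | zero =>
    rw [Function.iterate_one, gmap, Int.fract_eq_fract]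
    exact ⟨s, by push_cast; ring⟩
  | succ k ih =>
    rw [Function.iterate_succ_apply', ih, gmap_fract, pow_succ' _ (k + 1), mul_assoc]

/-- If `(-s) ^ k * x` exceeds an integer by an amount in `[0, x)`, then `x` is not in the
bifurcation set. -/
theorem notMem_Eset {s k : ℕ} (hk : k ≠ 0) {x : ℝ} (z : ℤ)
    (hnonneg : 0 ≤ (-(s : ℝ)) ^ k * x - z) (hlt : (-(s : ℝ)) ^ k * x - z < x) :
    x ∉ Eset s := by
  rintro ⟨⟨_, hx1⟩, hE⟩
  obtain ⟨j, rfl⟩ := Nat.exists_eq_succ_of_ne_zero hk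
  have h := hE (j + 1) (by omega)
  have hfract : Int.fract ((-(s : ℝ)) ^ (j + 1) * x) = (-(s : ℝ)) ^ (j + 1) * x - z :=
    Int.fract_eq_iff.2 ⟨hnonneg, hlt.trans_le hx1, z, by ring⟩
  rw [gmap_iterate_succ, hfract] at h
  exact absurd hlt (not_lt.2 h)

/-- A purely periodic expansion of even period whose period truncates to a number below
`s / (s + 1)` has value at most `s / (s + 1)`. -/
theorem pval_le_of_sval_lt {s : ℕ} (hs : 2 ≤ s) {w : List ℕ} (heven : Even w.length)
    (hne : w.length ≠ 0) (hlt : sval s w < (s : ℝ) / (s + 1)) :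
    pval s w ≤ (s : ℝ) / (s + 1) := by
  have hs1 : (1 : ℝ) < s := by exact_mod_cast hs
  have hM : 1 < (s : ℝ) ^ w.length := one_lt_pow₀ hs1 hne
  obtain ⟨p, hp⟩ := exists_nat_eq_sval_mul_pow (s := s) (by omega) w
  have hdvd : ((s : ℤ) + 1) ∣ (s : ℤ) ^ w.length - 1 := by
    have h := sub_dvd_pow_sub_pow (-(s : ℤ)) 1 w.length
    rw [heven.neg_pow, one_pow] at h
    rw [← neg_dvd]
    convert h using 1
    ring
  obtain ⟨K, hK⟩ := hdvd
  have hKR : (s : ℝ) ^ w.length = (s + 1) * K + 1 := by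
    have : (s : ℤ) ^ w.length = (s + 1) * K + 1 := by linarith
    exact_mod_cast this
  have hpR : (p : ℝ) * (s + 1) < s * (s : ℝ) ^ w.length := by
    rw [lt_div_iff₀ (by positivity)] at hlt
    rw [← hp]
    nlinarith
  have hpZ : (p : ℤ) * (s + 1) < s * ((s + 1) * K + 1) := by
    rw [hKR] at hpR
    exact_mod_cast hpR
  have hpK : (p : ℤ) ≤ s * K := by
    have : (p : ℤ) < s * K + 1 := by nlinarith
    omega
  have hpKR : (p : ℝ) ≤ s * K := by exact_mod_cast hpK
  rw [pval, hp, div_le_div_iff₀ (by linarith) (by positivity), hKR]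
  nlinarith

/-- for an `s`-adic rational `ξ ∈ (0,1)` with shortest even expansion `w` of
`ξ` and shortest odd expansion `v` of `1 − ξ`, the interval
`I_ξ = (ξ_L, ξ_R) = (.\overline{v̌v}, .\overline{w})` contains `ξ` and is disjoint from the
bifurcation set `E`; consequently, if moreover `ξ < s/(s+1)` then
`I_ξ ⊆ [0, s/(s+1)] \ E`. -/
theorem rational_interval_disjoint_from_E
    (s : ℕ) (hs : 2 ≤ s) (ξ : ℝ) (hξ : IsSAdic s ξ) (h0 : 0 < ξ) (h1 : ξ < 1)
    (w v : List ℕ) (hw : IsEvenExp s ξ w) (hv : IsOddExp s (1 - ξ) v) :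
    pval s (flipw s v ++ v) < ξ ∧ ξ < pval s w ∧
    Set.Ioo (pval s (flipw s v ++ v)) (pval s w) ∩ Eset s = ∅ ∧
    (ξ < (s : ℝ) / (s + 1) →
      Set.Ioo (pval s (flipw s v ++ v)) (pval s w) ⊆
        Set.Icc (0 : ℝ) ((s : ℝ) / (s + 1)) \ Eset s) := by
  obtain ⟨hw0, -, hweven, hwξ, -⟩ := hw
  obtain ⟨hvdig, hvodd, hvξ, -⟩ := hv
  have hs1 : (1 : ℝ) < s := by exact_mod_cast hs
  have hwlen : w.length ≠ 0 := by simpa using hw0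
  have hvlen : v.length ≠ 0 := hvodd.pos.ne'
  have hM : 1 < (s : ℝ) ^ w.length := one_lt_pow₀ hs1 hwlen
  have hN : 1 < (s : ℝ) ^ v.length := one_lt_pow₀ hs1 hvlen
  obtain ⟨p, hp⟩ := exists_nat_eq_sval_mul_pow (s := s) (by omega) w
  obtain ⟨q, hq⟩ := exists_nat_eq_sval_mul_pow (s := s) (by omega) v
  have hR : pval s w = ξ * (s : ℝ) ^ w.length / ((s : ℝ) ^ w.length - 1) := by rw [pval, hwξ]
  have hL : pval s (flipw s v ++ v) =
      (s : ℝ) ^ v.length * ξ / ((s : ℝ) ^ v.length + 1) := by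
    rw [pval_flipw_append hs hvdig hvlen, hvξ, sub_sub_cancel]
  rw [hwξ] at hp
  rw [hvξ] at hq
  have hnot : ∀ x ∈ Set.Ioo (pval s (flipw s v ++ v)) (pval s w), x ∉ Eset s := by
    rintro x ⟨hxL, hxR⟩
    rw [hL, div_lt_iff₀ (by linarith)] at hxL
    rw [hR, lt_div_iff₀ (by linarith)] at hxR
    rcases le_total x ξ with hx | hx
    · refine notMem_Eset hvlen (q - (s : ℤ) ^ v.length) ?_ ?_ <;>
      · push_cast
        rw [hvodd.neg_pow, ← hq]
        nlinarith
    · refine notMem_Eset hwlen p ?_ ?_ <;>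
      · push_cast
        rw [hweven.neg_pow, ← hp]
        nlinarith
  refine ⟨?_, ?_, ?_, ?_⟩
  · rw [hL, div_lt_iff₀ (by linarith)]
    nlinarith
  · rw [hR, lt_div_iff₀ (by linarith)]
    nlinarith
  · exact Set.eq_empty_of_forall_notMem fun x hx => hnot x hx.1 hx.2
  · intro hlt x hx
    refine ⟨⟨?_, ?_⟩, hnot x hx⟩
    · refine le_trans ?_ hx.1.le
      rw [hL]
      positivity
    · exact hx.2.le.trans (pval_le_of_sval_lt hs hweven hwlen (hwξ ▸ hlt))
end
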